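/- Let q = 2^f with f even. For every integer n ≥ 1 there exists an irreducible subgroup G of GL(d,q) with d = 3·2^{n−1} such that c_2(G) = (4/3)·d − 1, i.e. 3·c_2(G) = 4d − 3. In particular the bound of Theorem 1 with ε_q = 4/3 is attained for infinitely many d. -/

import Mathlib

/-- A composition series of a group `G`: an ascending chain of subgroups from `⊥` to `⊤`
in which each term is normal in the next, with simple quotients. -/
structure GroupCompSeries (G : Type*) [Group G] where
  len : ℕ
  ser : Fin (len + 1) → Subgroup G
  ser_bot : ser 0 = ⊥
  ser_top : ser (Fin.last len) = ⊤
  ser_le : ∀ i : Fin len, ser i.castSucc ≤ ser i.succ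
  ser_normal : ∀ i : Fin len, ((ser i.castSucc).subgroupOf (ser i.succ)).Normal
  ser_simple : ∀ i : Fin len,
    haveI := ser_normal i
    IsSimpleGroup (↥(ser i.succ) ⧸ (ser i.castSucc).subgroupOf (ser i.succ))

/-- The number of factors of order `p` in a composition series. -/
noncomputable def GroupCompSeries.count {G : Type*} [Group G]
    (S : GroupCompSeries G) (p : ℕ) : ℕ := by
  classical
  exact (Finset.univ.filter fun i : Fin S.len =>
    Nat.card (↥(S.ser i.succ) ⧸ (S.ser i.castSucc).subgroupOf (S.ser i.succ)) = p).card

/-- `cp p G` is the number of composition factors of `G` of order `p`, counted with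
multiplicity in a composition series (well defined by Jordan–Hölder). -/
noncomputable def cp (p : ℕ) (G : Type*) [Group G] : ℕ := by
  classical
  exact if h : Nonempty (GroupCompSeries G) then h.some.count p else 0

/-- The constant `ε_q` of Theorem 1, for `q = p ^ f`. -/
noncomputable def epsq (p f : ℕ) : ℚ := by
  classical
  exact if p = 2 ∧ Even f then 4 / 3
    else if ∃ n : ℕ, p = 2 ^ 2 ^ n + 1 then p / (p - 1)
    else 1

/-- A subgroup of `GL(d, F)` acts irreducibly on its natural module. -/
def natIrreducible {F : Type*} [Field F] {d : ℕ}
    (G : Subgroup (Matrix.GeneralLinearGroup (Fin d) F)) : Prop :=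
  (⊥ : Submodule F (Fin d → F)) ≠ ⊤ ∧
  ∀ W : Submodule F (Fin d → F),
    (∀ g ∈ G, ∀ v ∈ W, Matrix.mulVec (g : Matrix (Fin d) (Fin d) F) v ∈ W) →
      W = ⊥ ∨ W = ⊤


/-- A quotient by a maximal proper normal subgroup is simple. -/
theorem isSimpleGroup_quotient_of_maximal {H : Type*} [Group H] (L : Subgroup H) [L.Normal]
    (hL : L ≠ ⊤) (hmax : ∀ M : Subgroup H, M.Normal → M ≠ ⊤ → L ≤ M → M = L) :
    IsSimpleGroup (H ⧸ L) := by
  have : Nontrivial (H ⧸ L) := by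
    rw [← not_subsingleton_iff_nontrivial]
    exact fun h => hL (QuotientGroup.subgroup_eq_top_of_subsingleton L h)
  refine ⟨fun K hK => ?_⟩
  have hle : L ≤ K.comap (QuotientGroup.mk' L) := by
    simpa using MonoidHom.ker_le_comap (QuotientGroup.mk' L) K
  have hmc := Subgroup.map_comap_eq_self_of_surjective (QuotientGroup.mk'_surjective L) K
  by_cases h : K.comap (QuotientGroup.mk' L) = ⊤
  · right
    rw [← hmc, h]
    exact Subgroup.map_top_of_surjective _ (QuotientGroup.mk'_surjective L)
  · left
    rw [← hmc, hmax _ inferInstance h hle]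
    simp

/-- `K` is normal in `H` with simple quotient. -/
def IsMaximalNormalIn {G : Type*} [Group G] (K H : Subgroup G) : Prop :=
  K ≤ H ∧ ∃ _ : (K.subgroupOf H).Normal, IsSimpleGroup (↥H ⧸ K.subgroupOf H)

theorem exists_isMaximalNormalIn {G : Type*} [Group G] [Finite G] (H : Subgroup G) (hH : H ≠ ⊥) :
    ∃ K, IsMaximalNormalIn K H ∧ K < H := by
  have hfin : Set.Finite {M : Subgroup H | M.Normal ∧ M ≠ ⊤} := Set.toFinite _
  have : Nontrivial H := (Subgroup.nontrivial_iff_ne_bot H).2 hH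
  obtain ⟨L, hL⟩ := hfin.exists_maximal ⟨⊥, inferInstance, bot_ne_top⟩
  have hLn : L.Normal := hL.prop.1
  have hsub : (L.map H.subtype).subgroupOf H = L :=
    Subgroup.comap_map_eq_self_of_injective H.subtype_injective L
  have hle : L.map H.subtype ≤ H := Subgroup.map_subtype_le L
  have hsimple : IsSimpleGroup (↥H ⧸ L) := isSimpleGroup_quotient_of_maximal L hL.prop.2
    fun M hM hM' hLM => le_antisymm (hL.le_of_ge ⟨hM, hM'⟩ hLM) hLM
  refine ⟨L.map H.subtype, ⟨hle, ?_⟩, lt_of_le_of_ne hle fun h => hL.prop.2 ?_⟩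
  · rw [hsub]
    exact ⟨hLn, hsimple⟩
  · rw [← hsub, h, Subgroup.subgroupOf_self]

theorem exists_relSeries_isMaximalNormalIn {G : Type*} [Group G] [Finite G] (H : Subgroup G) :
    ∃ s : RelSeries {x : Subgroup G × Subgroup G | IsMaximalNormalIn x.1 x.2},
      s.head = ⊥ ∧ s.last = H := by
  induction H using WellFoundedLT.induction with
  | ind H ih =>
    by_cases hH : H = ⊥
    · exact ⟨RelSeries.singleton _ ⊥, rfl, hH.symm⟩
    · obtain ⟨K, hK, hlt⟩ := exists_isMaximalNormalIn H hH
      obtain ⟨s, hs, hs'⟩ := ih K hlt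
      refine ⟨s.snoc H (by simpa [hs'] using hK), by simpa using hs, by simp⟩

theorem GroupCompSeries.nonempty_of_finite (G : Type*) [Group G] [Finite G] :
    Nonempty (GroupCompSeries G) := by
  obtain ⟨s, hs, hs'⟩ := exists_relSeries_isMaximalNormalIn (⊤ : Subgroup G)
  exact ⟨{
    len := s.length
    ser := s.toFun
    ser_bot := hs
    ser_top := hs'
    ser_le := fun i => (s.step i).1
    ser_normal := fun i => (s.step i).2.1
    ser_simple := fun i => (s.step i).2.2 }⟩

/-- The order of the `i`-th factor of a composition series. -/
noncomputable def GroupCompSeries.factorCard {G : Type*} [Group G] (S : GroupCompSeries G)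
    (i : Fin S.len) : ℕ :=
  Nat.card (↥(S.ser i.succ) ⧸ (S.ser i.castSucc).subgroupOf (S.ser i.succ))

theorem GroupCompSeries.prod_factorCard {G : Type*} [Group G] (S : GroupCompSeries G) :
    ∏ i, S.factorCard i = Nat.card G := by
  have key : ∀ n : ℕ, ∀ s : Fin (n + 1) → Subgroup G,
      (∀ i : Fin n, s i.castSucc ≤ s i.succ) →
      (∏ i : Fin n, (s i.castSucc).relIndex (s i.succ)) * Nat.card (s 0) =
        Nat.card (s (Fin.last n)) := by
    intro n
    induction n with
    | zero => intro s _; simp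
    | succ n ih =>
      intro s hs
      have h := ih (fun i => s i.castSucc) fun i => hs i.castSucc
      rw [Fin.prod_univ_castSucc, mul_right_comm]
      simp only [Fin.succ_castSucc, Fin.castSucc_zero] at h ⊢
      rw [h]
      simpa using Subgroup.relIndex_mul_relIndex _ _ _ bot_le (hs (Fin.last n))
  have h := key S.len S.ser S.ser_le
  rw [S.ser_bot, S.ser_top] at h
  rw [← Subgroup.card_top, ← h, Subgroup.card_bot, mul_one]
  rfl

theorem GroupCompSeries.prime_factorCard {G : Type*} [Group G] [Finite G] [Group.IsSolvable G]
    (S : GroupCompSeries G) (i : Fin S.len) : (S.factorCard i).Prime := by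
  have := S.ser_normal i
  have := S.ser_simple i
  let : CommGroup (↥(S.ser i.succ) ⧸ (S.ser i.castSucc).subgroupOf (S.ser i.succ)) :=
    { (inferInstance : Group (↥(S.ser i.succ) ⧸ (S.ser i.castSucc).subgroupOf (S.ser i.succ))) with
      mul_comm := IsSimpleGroup.comm_iff_isSolvable.2 inferInstance }
  exact IsSimpleGroup.prime_card

theorem GroupCompSeries.count_eq_factorization {G : Type*} [Group G] [Finite G]
    [Group.IsSolvable G] (S : GroupCompSeries G) (p : ℕ) :
    S.count p = (Nat.card G).factorization p := by
  classical
  rw [← S.prod_factorCard, Nat.factorization_prod fun i _ => (S.prime_factorCard i).ne_zero,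
    Finsupp.finsetSum_apply, GroupCompSeries.count, Finset.card_filter]
  refine Finset.sum_congr (by congr) fun i _ => ?_
  rw [(S.prime_factorCard i).factorization, Finsupp.single_apply]
  rfl

/-- In a finite solvable group, the number of composition factors of order `p` is the
multiplicity of `p` in the group order. -/
theorem cp_eq_factorization (p : ℕ) (G : Type*) [Group G] [Finite G] [Group.IsSolvable G] :
    cp p G = (Nat.card G).factorization p := by
  rw [cp, dif_pos (GroupCompSeries.nonempty_of_finite G)]
  exact GroupCompSeries.count_eq_factorization _ p

theorem Subgroup.mem_normalizer_of_forall_conj_mem {M : Type*} [Group M] (N : Subgroup M)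
    [Finite N] (g : M) (h : ∀ x ∈ N, g * x * g⁻¹ ∈ N) : g ∈ Subgroup.normalizer (N : Set M) := by
  rw [Subgroup.mem_normalizer_iff_map_conj_eq]
  refine Subgroup.eq_of_le_of_card_ge ?_ ?_
  · rintro _ ⟨x, hx, rfl⟩
    exact h x hx
  · exact (Subgroup.card_map_of_injective (MulAut.conj g).injective).ge

section Extension

variable {M : Type*} [Group M] (N : Subgroup M) (g : M) (p : ℕ)

/-- Adjoining an element `g` normalizing `N` with `g ^ p ∈ N` preserves solvability and multiplies
the order by a divisor of `p`, which is `1` only if `g ∈ N`. -/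
theorem Subgroup.exists_card_sup_zpowers [Group.IsSolvable N]
    (hn : g ∈ Subgroup.normalizer (N : Set M)) (hg : g ^ p ∈ N) :
    Group.IsSolvable ↥(N ⊔ Subgroup.zpowers g) ∧ ∃ k, k ∣ p ∧ (k = 1 → g ∈ N) ∧
      Nat.card ↥(N ⊔ Subgroup.zpowers g) = k * Nat.card N := by
  set H := N ⊔ Subgroup.zpowers g with hH
  have hNH : N ≤ H := le_sup_left
  have hgH : g ∈ H := le_sup_right (a := N) (Subgroup.mem_zpowers g)
  have hnorm : (N.subgroupOf H).Normal := by
    rw [Subgroup.normal_subgroupOf_iff_le_normalizer hNH]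
    exact sup_le Subgroup.le_normalizer (by simpa using hn)
  let q : H →* H ⧸ N.subgroupOf H := QuotientGroup.mk' _
  have hker : ∀ x : H, q x = 1 ↔ (x : M) ∈ N := fun x => by
    rw [QuotientGroup.mk'_apply, QuotientGroup.eq_one_iff, Subgroup.mem_subgroupOf]
  have hgen : ∀ x, x ∈ Subgroup.zpowers (q ⟨g, hgH⟩) := by
    have hle : H ≤ ((Subgroup.zpowers (q ⟨g, hgH⟩)).comap q).map H.subtype := by
      refine sup_le (fun x hx => ⟨⟨x, hNH hx⟩, ?_, rfl⟩) ?_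
      · have : q ⟨x, hNH hx⟩ = 1 := (hker _).2 hx
        simp [this]
      · rw [Subgroup.zpowers_le]
        exact ⟨⟨g, hgH⟩, by simp, rfl⟩
    intro x
    obtain ⟨y, rfl⟩ := QuotientGroup.mk'_surjective _ x
    obtain ⟨z, hz, hzy⟩ := hle y.2
    rwa [← Subtype.ext hzy]
  have hcyc : IsCyclic (H ⧸ N.subgroupOf H) := ⟨_, hgen⟩
  let := IsCyclic.commGroup (α := H ⧸ N.subgroupOf H)
  have hNs : Group.IsSolvable (N.subgroupOf H) :=
    Group.isSolvable_of_isSolvable_injective (f := (Subgroup.subgroupOfEquivOfLe hNH).toMonoidHom)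
      (Subgroup.subgroupOfEquivOfLe hNH).injective
  refine ⟨(Group.isSolvable_iff_subgroup_quotient (N.subgroupOf H)).2 ⟨hNs, inferInstance⟩,
    orderOf (q ⟨g, hgH⟩), ?_, fun h => ?_, ?_⟩
  · rw [orderOf_dvd_iff_pow_eq_one, ← map_pow, hker]
    simpa using hg
  · simpa [hker] using orderOf_eq_one_iff.1 h
  · rw [orderOf_eq_card_of_forall_mem_zpowers hgen]
    have h := Subgroup.relIndex_mul_relIndex _ _ _ bot_le hNH
    rw [Subgroup.relIndex_bot_left, Subgroup.relIndex_bot_left] at h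
    rw [← h, mul_comm]
    rfl

end Extension

/-- A finite solvable irreducible linear group without nonzero fixed vectors, in whose order the
prime `2` has multiplicity `k`. -/
structure IsIrredSolvable {F V : Type*} [Field F] [AddCommGroup V] [Module F V]
    (G : Subgroup (V ≃ₗ[F] V)) (k : ℕ) : Prop where
  finite : Finite G
  isSolvable : Group.IsSolvable G
  factorization_card : (Nat.card G).factorization 2 = k
  eq_bot_or_eq_top : ∀ W : Submodule F V, (∀ g ∈ G, ∀ v ∈ W, g v ∈ W) → W = ⊥ ∨ W = ⊤
  eq_zero_of_fixed : ∀ v : V, (∀ g ∈ G, g v = v) → v = 0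

section Wreath

variable {F V : Type*} [Field F] [AddCommGroup V] [Module F V]

/-- The block-diagonal embedding of pairs of automorphisms of `V` into those of `V × V`. -/
def blockDiagHom (F V : Type*) [Field F] [AddCommGroup V] [Module F V] :
    (V ≃ₗ[F] V) × (V ≃ₗ[F] V) →* ((V × V) ≃ₗ[F] (V × V)) where
  toFun x := x.1.prodCongr x.2
  map_one' := rfl
  map_mul' _ _ := rfl

theorem blockDiagHom_injective : Function.Injective (blockDiagHom F V) := by
  rintro ⟨a, b⟩ ⟨c, d⟩ h
  have h' : ∀ v w, (a v, b w) = (c v, d w) := fun v w => LinearEquiv.congr_fun h (v, w)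
  refine Prod.ext (LinearEquiv.ext fun v => ?_) (LinearEquiv.ext fun v => ?_)
  · exact congrArg Prod.fst (h' v v)
  · exact congrArg Prod.snd (h' v v)

/-- The wreath product of a linear group on `V` with the group of order two, acting on `V × V`. -/
def wreathTwo (G : Subgroup (V ≃ₗ[F] V)) : Subgroup ((V × V) ≃ₗ[F] (V × V)) :=
  (G.prod G).map (blockDiagHom F V) ⊔ Subgroup.zpowers (LinearEquiv.prodComm F V V)

theorem blockDiagHom_mem_wreathTwo {G : Subgroup (V ≃ₗ[F] V)} {a b : V ≃ₗ[F] V} (ha : a ∈ G)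
    (hb : b ∈ G) : blockDiagHom F V (a, b) ∈ wreathTwo G :=
  Subgroup.mem_sup_left ⟨(a, b), ⟨ha, hb⟩, rfl⟩

theorem prodComm_mem_wreathTwo (G : Subgroup (V ≃ₗ[F] V)) :
    LinearEquiv.prodComm F V V ∈ wreathTwo G :=
  Subgroup.mem_sup_right (Subgroup.mem_zpowers _)

theorem isSolvable_and_card_wreathTwo [Nontrivial V] (G : Subgroup (V ≃ₗ[F] V)) [Finite G]
    [Group.IsSolvable G] :
    Group.IsSolvable (wreathTwo G) ∧ Nat.card (wreathTwo G) = 2 * (Nat.card G * Nat.card G) := by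
  set N := (G.prod G).map (blockDiagHom F V) with hN
  let e : N ≃* G × G :=
    ((G.prod G).equivMapOfInjective _ blockDiagHom_injective).symm.trans (G.prodEquiv G)
  have hcard : Nat.card N = Nat.card G * Nat.card G := by
    rw [Nat.card_congr e.toEquiv, Nat.card_prod]
  have : Finite N := Finite.of_equiv _ e.symm.toEquiv
  have : Group.IsSolvable N :=
    Group.isSolvable_of_isSolvable_injective (f := e.toMonoidHom) e.injective
  have hnorm : LinearEquiv.prodComm F V V ∈ Subgroup.normalizer (N : Set _) := by
    refine N.mem_normalizer_of_forall_conj_mem _ ?_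
    rintro _ ⟨⟨a, b⟩, ⟨ha, hb⟩, rfl⟩
    exact ⟨(b, a), ⟨hb, ha⟩, rfl⟩
  have hnot : LinearEquiv.prodComm F V V ∉ N := by
    rintro ⟨⟨a, b⟩, -, h⟩
    obtain ⟨v, hv⟩ := exists_ne (0 : V)
    have h' : ((a 0, b v) : V × V) = (v, 0) := LinearEquiv.congr_fun h (0, v)
    exact hv (by simpa using (congrArg Prod.fst h').symm)
  obtain ⟨hs, k, hk, hk1, hc⟩ := N.exists_card_sup_zpowers _ 2 hnorm
    (by rw [show LinearEquiv.prodComm F V V ^ 2 = 1 from rfl]; exact N.one_mem)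
  refine ⟨hs, ?_⟩
  have hk2 : k = 2 := ((Nat.dvd_prime Nat.prime_two).1 hk).resolve_left fun h => hnot (hk1 h)
  rw [← hcard, ← hk2]
  exact hc

theorem wreathTwo_eq_bot_or_eq_top {G : Subgroup (V ≃ₗ[F] V)} {k : ℕ} (hG : IsIrredSolvable G k)
    (W : Submodule F (V × V)) (hW : ∀ g ∈ wreathTwo G, ∀ v ∈ W, g v ∈ W) : W = ⊥ ∨ W = ⊤ := by
  have hswap : ∀ v w, (v, w) ∈ W → (w, v) ∈ W := fun v w h =>
    hW _ (prodComm_mem_wreathTwo G) _ h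
  have hact : ∀ g ∈ G, ∀ v w, (v, w) ∈ W → (g v, w) ∈ W := fun g hg v w h =>
    hW _ (blockDiagHom_mem_wreathTwo hg G.one_mem) _ h
  rcases hG.eq_bot_or_eq_top (W.comap (LinearMap.inl F V V))
    (fun g hg v hv => hact g hg v 0 hv) with h | h
  · left
    have hfst : ∀ v w, (v, w) ∈ W → v = 0 := by
      refine fun v w hvw => hG.eq_zero_of_fixed v fun g hg => ?_
      have hsub := W.sub_mem (hact g hg v w hvw) hvw
      have hmem : g v - v ∈ W.comap (LinearMap.inl F V V) := by simpa using hsub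
      rw [h, Submodule.mem_bot] at hmem
      exact sub_eq_zero.1 hmem
    refine (Submodule.eq_bot_iff W).2 ?_
    rintro ⟨v, w⟩ hvw
    exact Prod.ext (hfst v w hvw) (hfst w v (hswap v w hvw))
  · right
    have hinl : ∀ v, (v, 0) ∈ W := fun v => by
      have : v ∈ W.comap (LinearMap.inl F V V) := h ▸ Submodule.mem_top
      exact this
    refine (Submodule.eq_top_iff'.2 ?_)
    rintro ⟨v, w⟩
    simpa using W.add_mem (hinl v) (hswap w 0 (hinl w))

theorem IsIrredSolvable.wreathTwo [Nontrivial V] {G : Subgroup (V ≃ₗ[F] V)} {k : ℕ}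
    (hG : IsIrredSolvable G k) : IsIrredSolvable (wreathTwo G) (2 * k + 1) := by
  have := hG.finite
  have := hG.isSolvable
  have hpos : Nat.card G ≠ 0 := Nat.card_pos.ne'
  obtain ⟨hs, hc⟩ := isSolvable_and_card_wreathTwo G
  refine ⟨Nat.finite_of_card_ne_zero (by simp [hc, hpos]), hs, ?_, wreathTwo_eq_bot_or_eq_top hG,
    ?_⟩
  · rw [hc, Nat.factorization_mul two_ne_zero (mul_ne_zero hpos hpos),
      Nat.factorization_mul hpos hpos]
    simp only [Finsupp.add_apply, hG.factorization_card, Nat.prime_two.factorization_self]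
    ring
  · rintro ⟨v, w⟩ h
    refine Prod.ext (hG.eq_zero_of_fixed v fun g hg => ?_) (hG.eq_zero_of_fixed w fun g hg => ?_)
    · exact congrArg Prod.fst (h _ (blockDiagHom_mem_wreathTwo hg G.one_mem))
    · exact congrArg Prod.snd (h _ (blockDiagHom_mem_wreathTwo G.one_mem hg))

end Wreath

theorem IsIrredSolvable.exists_natIrreducible {F V : Type*} [Field F] [AddCommGroup V] [Module F V]
    [FiniteDimensional F V] [Nontrivial V] {G : Subgroup (V ≃ₗ[F] V)} {k d : ℕ}
    (hG : IsIrredSolvable G k) (hd : Module.finrank F V = d) :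
    ∃ H : Subgroup (Matrix.GeneralLinearGroup (Fin d) F), natIrreducible H ∧ cp 2 H = k := by
  let b : Module.Basis (Fin d) F V := Module.finBasisOfFinrankEq F V hd
  let φ : Matrix.GeneralLinearGroup (Fin d) F ≃* (V ≃ₗ[F] V) :=
    (Matrix.GeneralLinearGroup.toLin' b).trans (LinearMap.GeneralLinearGroup.generalLinearEquiv F V)
  obtain ⟨ε, hε⟩ : ∃ ε : V ≃ₗ[F] (Fin d → F), ∀ g v,
      φ g v = ε.symm ((g : Matrix (Fin d) (Fin d) F).mulVec (ε v)) := ⟨b.equivFun, fun g v => by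
    simp [φ, Matrix.GeneralLinearGroup.toLin', Matrix.GeneralLinearGroup.toLin]⟩
  let e : G ≃* G.map φ.symm.toMonoidHom := G.equivMapOfInjective _ φ.symm.injective
  have := hG.finite
  have := hG.isSolvable
  have : Finite (G.map φ.symm.toMonoidHom) := Finite.of_equiv _ e.toEquiv
  have : Group.IsSolvable (G.map φ.symm.toMonoidHom) :=
    Group.isSolvable_of_surjective (f := e.toMonoidHom) e.surjective
  refine ⟨G.map φ.symm.toMonoidHom, ⟨?_, fun W hW => ?_⟩, ?_⟩
  · have : Nontrivial (Fin d → F) := ε.symm.toEquiv.nontrivial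
    exact bot_ne_top
  · rcases hG.eq_bot_or_eq_top (W.comap (ε : V →ₗ[F] (Fin d → F))) fun g hg v hv => by
        have h := hW (φ.symm g) ⟨g, hg, rfl⟩ _ hv
        have h2 := hε (φ.symm g) v
        rw [MulEquiv.apply_symm_apply] at h2
        simpa [h2] using h with h | h
    · left
      refine (Submodule.eq_bot_iff W).2 fun x hx => ?_
      have : ε.symm x ∈ W.comap (ε : V →ₗ[F] (Fin d → F)) := by
        simpa using hx
      rw [h, Submodule.mem_bot] at this
      simpa using this
    · right
      refine Submodule.eq_top_iff'.2 fun x => ?_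
      have : ε.symm x ∈ W.comap (ε : V →ₗ[F] (Fin d → F)) :=
        h ▸ Submodule.mem_top
      simpa using this
  · rw [cp_eq_factorization, ← Nat.card_congr e.toEquiv, hG.factorization_card]

section Extraspecial

variable {M : Type*} [Group M]

theorem Subgroup.isSolvable_odd_card_sup_zpowers (N : Subgroup M) (g : M)
    (h : Group.IsSolvable N ∧ Odd (Nat.card N))
    (hconj : N ≤ N.comap (MulAut.conj g).toMonoidHom) (hg : g ^ 3 ∈ N) :
    Group.IsSolvable ↥(N ⊔ Subgroup.zpowers g) ∧ Odd (Nat.card ↥(N ⊔ Subgroup.zpowers g)) := by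
  have := h.1
  have : Finite N := Nat.finite_of_card_ne_zero h.2.pos.ne'
  obtain ⟨hs, k, hk, -, hc⟩ := N.exists_card_sup_zpowers g 3
    (N.mem_normalizer_of_forall_conj_mem g hconj) hg
  refine ⟨hs, hc ▸ Odd.mul (Odd.of_dvd_nat (by decide) hk) h.2⟩

theorem Subgroup.isSolvable_card_sup_zpowers_two (N : Subgroup M) (g : M) {m : ℕ} (hm : m ≠ 0)
    (h : Group.IsSolvable N ∧ Nat.card N = m)
    (hconj : N ≤ N.comap (MulAut.conj g).toMonoidHom) (hg : g ^ 2 ∈ N) (hgN : g ∉ N) :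
    Group.IsSolvable ↥(N ⊔ Subgroup.zpowers g) ∧
      Nat.card ↥(N ⊔ Subgroup.zpowers g) = 2 * m := by
  have := h.1
  have : Finite N := Nat.finite_of_card_ne_zero (h.2 ▸ hm)
  obtain ⟨hs, k, hk, hk1, hc⟩ := N.exists_card_sup_zpowers g 2
    (N.mem_normalizer_of_forall_conj_mem g hconj) hg
  have hk2 : k = 2 := ((Nat.dvd_prime Nat.prime_two).1 hk).resolve_left fun h => hgN (hk1 h)
  exact ⟨hs, by rw [hc, h.2, hk2]⟩

/-- If `a` normalizes `E`, then so does every element of `E ⊔ ⟨a ^ 2⟩ ⊔ ⟨a⟩`, and its commutators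
with `a` lie in `E`. -/
theorem Subgroup.commutator_mem_of_mem_sup (E : Subgroup M) (a : M)
    (ha : a ∈ Subgroup.normalizer (E : Set M)) {x : M}
    (hx : x ∈ E ⊔ Subgroup.zpowers (a ^ 2) ⊔ Subgroup.zpowers a) : a * x * a⁻¹ * x⁻¹ ∈ E := by
  have hx' : x ∈ Subgroup.closure ((E : Set M) ∪ {a}) := by
    have hac : a ∈ Subgroup.closure ((E : Set M) ∪ {a}) :=
      Subgroup.subset_closure (Set.mem_union_right _ rfl)
    have hle : E ⊔ Subgroup.zpowers (a ^ 2) ⊔ Subgroup.zpowers a ≤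
        Subgroup.closure ((E : Set M) ∪ {a}) :=
      sup_le (sup_le (fun y hy => Subgroup.subset_closure (Set.mem_union_left _ hy))
        (Subgroup.zpowers_le.2 (Subgroup.pow_mem _ hac 2))) (Subgroup.zpowers_le.2 hac)
    exact hle hx
  suffices h : x ∈ Subgroup.normalizer (E : Set M) ∧ a * x * a⁻¹ * x⁻¹ ∈ E from h.2
  clear hx
  induction hx' using Subgroup.closure_induction with
  | mem y hy =>
    rcases hy with hy | rfl
    · exact ⟨Subgroup.le_normalizer hy,
        E.mul_mem ((Subgroup.mem_normalizer_iff.1 ha y).1 hy) (E.inv_mem hy)⟩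
    · exact ⟨ha, by simp⟩
  | one => exact ⟨Subgroup.one_mem _, by simp⟩
  | mul y z _ _ hy hz =>
    refine ⟨Subgroup.mul_mem _ hy.1 hz.1, ?_⟩
    have h := E.mul_mem hy.2 ((Subgroup.mem_normalizer_iff.1 hy.1 _).1 hz.2)
    convert h using 1
    group
  | inv y _ hy =>
    refine ⟨Subgroup.inv_mem _ hy.1, ?_⟩
    have h := E.inv_mem ((Subgroup.mem_normalizer_iff''.1 hy.1 _).1 hy.2)
    convert h using 1
    group

/-- Relations of the group `3^{1+2} : Q₈`: the elements `s`, `z`, `x` generate the extraspecial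
group with centre generated by `s`, and `a`, `b` generate the quaternion group. -/
structure ExtraspecialQuaternion (s z x a b : M) : Prop where
  s_pow : s ^ 3 = 1
  z_pow : z ^ 3 = 1
  x_pow : x ^ 3 = 1
  a_pow : a ^ 4 = 1
  a_sq_ne : a ^ 2 ≠ 1
  b_sq : b ^ 2 = a ^ 2
  z_s : z * s = s * z
  x_s : x * s = s * x
  a_s : a * s = s * a
  b_s : b * s = s * b
  x_z : x * z = s ^ 2 * z * x
  a_z : a * z = x ^ 2 * a
  a_x : a * x = z * a
  b_z : b * z = s * x ^ 2 * z * b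
  b_x : b * x = s ^ 2 * x ^ 2 * z ^ 2 * b
  b_a : b * a = a ^ 3 * b

/-- The extraspecial part. -/
def extraspecialSubgroup (s z x : M) : Subgroup M :=
  ⊥ ⊔ Subgroup.zpowers s ⊔ Subgroup.zpowers z ⊔ Subgroup.zpowers x

/-- The whole group, built up by a chain of cyclic extensions. -/
def extraspecialQuaternionSubgroup (s z x a b : M) : Subgroup M :=
  extraspecialSubgroup s z x ⊔ Subgroup.zpowers (a ^ 2) ⊔ Subgroup.zpowers a ⊔ Subgroup.zpowers b

variable {s z x a b : M}

theorem s_mem_extraspecialSubgroup (s z x : M) : s ∈ extraspecialSubgroup s z x :=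
  Subgroup.mem_sup_left (Subgroup.mem_sup_left (Subgroup.mem_sup_right (Subgroup.mem_zpowers s)))

theorem z_mem_extraspecialSubgroup (s z x : M) : z ∈ extraspecialSubgroup s z x :=
  Subgroup.mem_sup_left (Subgroup.mem_sup_right (Subgroup.mem_zpowers z))

theorem x_mem_extraspecialSubgroup (s z x : M) : x ∈ extraspecialSubgroup s z x :=
  Subgroup.mem_sup_right (Subgroup.mem_zpowers x)

theorem mem_comap_conj_of_mul_eq {N : Subgroup M} {g y w : M} (h : g * y = w * g) (hw : w ∈ N) :
    y ∈ N.comap (MulAut.conj g).toMonoidHom := by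
  have : g * y * g⁻¹ = w := mul_inv_eq_of_eq_mul h
  simpa [this] using hw

theorem extraspecialSubgroup_le {s z x : M} {K : Subgroup M} (hs : s ∈ K) (hz : z ∈ K)
    (hx : x ∈ K) : extraspecialSubgroup s z x ≤ K :=
  sup_le (sup_le (sup_le bot_le (Subgroup.zpowers_le.2 hs)) (Subgroup.zpowers_le.2 hz))
    (Subgroup.zpowers_le.2 hx)

namespace ExtraspecialQuaternion

theorem isSolvable_odd_card (h : ExtraspecialQuaternion s z x a b) :
    Group.IsSolvable (extraspecialSubgroup s z x) ∧
      Odd (Nat.card (extraspecialSubgroup s z x)) := by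
  have hss : s ∈ (⊥ ⊔ Subgroup.zpowers s : Subgroup M) :=
    Subgroup.mem_sup_right (Subgroup.mem_zpowers s)
  have hsz : s ∈ (⊥ ⊔ Subgroup.zpowers s ⊔ Subgroup.zpowers z : Subgroup M) :=
    Subgroup.mem_sup_left hss
  have hzz : z ∈ (⊥ ⊔ Subgroup.zpowers s ⊔ Subgroup.zpowers z : Subgroup M) :=
    Subgroup.mem_sup_right (Subgroup.mem_zpowers z)
  refine Subgroup.isSolvable_odd_card_sup_zpowers _ x (Subgroup.isSolvable_odd_card_sup_zpowers _ z
    (Subgroup.isSolvable_odd_card_sup_zpowers _ s ⟨inferInstance, by simp⟩ bot_le ?_) ?_ ?_) ?_ ?_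
  · exact h.s_pow ▸ Subgroup.one_mem _
  · exact sup_le bot_le (Subgroup.zpowers_le.2 (mem_comap_conj_of_mul_eq h.z_s hss))
  · exact h.z_pow ▸ Subgroup.one_mem _
  · exact sup_le (sup_le bot_le (Subgroup.zpowers_le.2 (mem_comap_conj_of_mul_eq h.x_s hsz)))
      (Subgroup.zpowers_le.2 (mem_comap_conj_of_mul_eq h.x_z
        (Subgroup.mul_mem _ (Subgroup.pow_mem _ hsz 2) hzz)))
  · exact h.x_pow ▸ Subgroup.one_mem _

theorem le_comap_conj_a (h : ExtraspecialQuaternion s z x a b) :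
    extraspecialSubgroup s z x ≤
      (extraspecialSubgroup s z x).comap (MulAut.conj a).toMonoidHom :=
  extraspecialSubgroup_le (mem_comap_conj_of_mul_eq h.a_s (s_mem_extraspecialSubgroup s z x))
    (mem_comap_conj_of_mul_eq h.a_z (Subgroup.pow_mem _ (x_mem_extraspecialSubgroup s z x) 2))
    (mem_comap_conj_of_mul_eq h.a_x (z_mem_extraspecialSubgroup s z x))

theorem le_comap_conj_a_sq (h : ExtraspecialQuaternion s z x a b) :
    extraspecialSubgroup s z x ≤
      (extraspecialSubgroup s z x).comap (MulAut.conj (a ^ 2)).toMonoidHom := by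
  intro y hy
  have := h.le_comap_conj_a (h.le_comap_conj_a hy)
  simpa [pow_two, mul_assoc] using this

theorem le_comap_conj_b (h : ExtraspecialQuaternion s z x a b) :
    extraspecialSubgroup s z x ≤
      (extraspecialSubgroup s z x).comap (MulAut.conj b).toMonoidHom := by
  have hs := s_mem_extraspecialSubgroup s z x
  have hz := z_mem_extraspecialSubgroup s z x
  have hx := x_mem_extraspecialSubgroup s z x
  refine extraspecialSubgroup_le (mem_comap_conj_of_mul_eq h.b_s hs)
    (mem_comap_conj_of_mul_eq h.b_z ?_) (mem_comap_conj_of_mul_eq h.b_x ?_)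
  · exact Subgroup.mul_mem _ (Subgroup.mul_mem _ hs (Subgroup.pow_mem _ hx 2)) hz
  · exact Subgroup.mul_mem _ (Subgroup.mul_mem _ (Subgroup.pow_mem _ hs 2)
      (Subgroup.pow_mem _ hx 2)) (Subgroup.pow_mem _ hz 2)

theorem a_sq_notMem (h : ExtraspecialQuaternion s z x a b) :
    a ^ 2 ∉ extraspecialSubgroup s z x := by
  intro hmem
  have horder : orderOf (a ^ 2) = 2 :=
    orderOf_eq_prime (by rw [← pow_mul]; exact h.a_pow) h.a_sq_ne
  have hdvd := (extraspecialSubgroup s z x).orderOf_dvd_natCard hmem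
  rw [horder] at hdvd
  exact (Nat.not_even_iff_odd.2 h.isSolvable_odd_card.2) (even_iff_two_dvd.2 hdvd)

/-- The group `3^{1+2} : Q₈` is solvable, and its order is `8` times an odd number. -/
theorem isSolvable_factorization_card (h : ExtraspecialQuaternion s z x a b) :
    Group.IsSolvable (extraspecialQuaternionSubgroup s z x a b) ∧
      Nat.card (extraspecialQuaternionSubgroup s z x a b) ≠ 0 ∧
      (Nat.card (extraspecialQuaternionSubgroup s z x a b)).factorization 2 = 3 := by
  obtain ⟨hsol, hodd⟩ := h.isSolvable_odd_card
  set E := extraspecialSubgroup s z x with hE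
  set m := Nat.card E with hm
  have hm0 : m ≠ 0 := hodd.pos.ne'
  have hfin : Finite E := Nat.finite_of_card_ne_zero hm0
  have hsq : Group.IsSolvable ↥(E ⊔ Subgroup.zpowers (a ^ 2)) ∧
      Nat.card ↥(E ⊔ Subgroup.zpowers (a ^ 2)) = 2 * m := by
    refine Subgroup.isSolvable_card_sup_zpowers_two E _ hm0 ⟨hsol, rfl⟩ h.le_comap_conj_a_sq ?_
      h.a_sq_notMem
    rw [← pow_mul, h.a_pow]
    exact E.one_mem
  have ha2 : a ^ 2 ∈ E ⊔ Subgroup.zpowers (a ^ 2) :=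
    Subgroup.mem_sup_right (Subgroup.mem_zpowers _)
  have ha : Group.IsSolvable ↥(E ⊔ Subgroup.zpowers (a ^ 2) ⊔ Subgroup.zpowers a) ∧
      Nat.card ↥(E ⊔ Subgroup.zpowers (a ^ 2) ⊔ Subgroup.zpowers a) = 2 * (2 * m) := by
    refine Subgroup.isSolvable_card_sup_zpowers_two _ _ (by simpa using hm0) hsq
      (sup_le ?_ (Subgroup.zpowers_le.2 (mem_comap_conj_of_mul_eq ?_ ha2))) ha2 fun hmem => ?_
    · exact h.le_comap_conj_a.trans (Subgroup.comap_mono le_sup_left)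
    · rw [← pow_succ, ← pow_succ']
    · have horder : orderOf a = 2 ^ (1 + 1) :=
        orderOf_eq_prime_pow (by simpa using h.a_sq_ne) (by simpa using h.a_pow)
      have hdvd := Subgroup.orderOf_dvd_natCard _ hmem
      rw [horder, hsq.2] at hdvd
      obtain ⟨r, hr⟩ := hodd
      omega
  have haE : a ∈ Subgroup.normalizer (E : Set M) :=
    E.mem_normalizer_of_forall_conj_mem a h.le_comap_conj_a
  have haN : a ∈ E ⊔ Subgroup.zpowers (a ^ 2) ⊔ Subgroup.zpowers a :=
    Subgroup.mem_sup_right (Subgroup.mem_zpowers _)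
  have hb := Subgroup.isSolvable_card_sup_zpowers_two _ b (by simpa using hm0) ha
    (sup_le (sup_le ?_ (Subgroup.zpowers_le.2 ?_)) (Subgroup.zpowers_le.2
      (mem_comap_conj_of_mul_eq h.b_a (Subgroup.pow_mem _ haN 3))))
    (by rw [h.b_sq]; exact Subgroup.mem_sup_left ha2) fun hmem => ?_
  · refine ⟨hb.1, ?_⟩
    have hc : Nat.card (extraspecialQuaternionSubgroup s z x a b) = 2 ^ 3 * m := by
      rw [show 2 ^ 3 * m = 2 * (2 * (2 * m)) by ring]
      exact hb.2
    rw [hc]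
    refine ⟨by simpa using hm0, ?_⟩
    rw [Nat.factorization_mul (by norm_num) hm0, Nat.prime_two.factorization_pow]
    simp [Nat.factorization_eq_zero_of_not_dvd hodd.not_two_dvd_nat]
  · exact h.le_comap_conj_b.trans (Subgroup.comap_mono (le_sup_left.trans le_sup_left))
  · refine mem_comap_conj_of_mul_eq (w := a ^ 2) ?_ (Subgroup.mem_sup_left ha2)
    rw [← h.b_sq, ← pow_succ, ← pow_succ']
  · refine h.a_sq_notMem ?_
    have hcomm := E.inv_mem (E.commutator_mem_of_mem_sup a haE hmem)
    have : (a * b * a⁻¹ * b⁻¹)⁻¹ = a ^ 2 := by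
      rw [show (a * b * a⁻¹ * b⁻¹)⁻¹ = b * a * b⁻¹ * a⁻¹ by group, h.b_a]
      group
    rwa [this] at hcomm

end ExtraspecialQuaternion

end Extraspecial

section BaseGroup

variable {F : Type*} [Field F]

theorem exists_primitive_cube_root [Fintype F] {f : ℕ} (hf : 0 < f) (hfe : Even f)
    (hF : Fintype.card F = 2 ^ f) : (2 : F) = 0 ∧ ∃ w : F, w ^ 2 + w + 1 = 0 := by
  classical
  refine ⟨?_, ?_⟩
  · have h := FiniteField.cast_card_eq_zero F
    rw [hF, Nat.cast_pow] at h
    exact_mod_cast eq_zero_of_pow_eq_zero h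
  · have hdvd : 3 ∣ Fintype.card Fˣ := by
      rw [Fintype.card_units, hF]
      obtain ⟨r, rfl⟩ := hfe
      rw [← two_mul, pow_mul]
      have h := Nat.sub_dvd_pow_sub_pow (2 ^ 2) 1 r
      rwa [one_pow] at h
    obtain ⟨u, hu⟩ := exists_prime_orderOf_dvd_card 3 hdvd
    refine ⟨u, ?_⟩
    have h3 : (u : F) ^ 3 = 1 := by
      rw [← Units.val_pow_eq_pow_val, ← hu, pow_orderOf_eq_one, Units.val_one]
    have h1 : (u : F) - 1 ≠ 0 := by
      intro h
      have : u = 1 := Units.ext (sub_eq_zero.1 h)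
      simp [this] at hu
    refine (mul_eq_zero.1 (?_ : ((u : F) - 1) * _ = 0)).resolve_left h1
    linear_combination h3

/-- The scalar matrix `w`, for a primitive cube root of unity `w`. -/
def scalarGL (w : F) (hw : w ^ 2 + w + 1 = 0) : GL (Fin 3) F where
  val := !![w, 0, 0; 0, w, 0; 0, 0, w]
  inv := !![w ^ 2, 0, 0; 0, w ^ 2, 0; 0, 0, w ^ 2]
  val_inv := by
    ext i j
    fin_cases i <;> fin_cases j <;> simp [Matrix.mul_apply, Fin.sum_univ_three] <;> grind
  inv_val := by
    ext i j
    fin_cases i <;> fin_cases j <;> simp [Matrix.mul_apply, Fin.sum_univ_three] <;> grind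

/-- The diagonal matrix with entries `1, w, w ^ 2`, for a primitive cube root of unity `w`. -/
def clockGL (w : F) (hw : w ^ 2 + w + 1 = 0) : GL (Fin 3) F where
  val := !![1, 0, 0; 0, w, 0; 0, 0, w ^ 2]
  inv := !![1, 0, 0; 0, w ^ 2, 0; 0, 0, w]
  val_inv := by
    ext i j
    fin_cases i <;> fin_cases j <;> simp [Matrix.mul_apply, Fin.sum_univ_three] <;> grind
  inv_val := by
    ext i j
    fin_cases i <;> fin_cases j <;> simp [Matrix.mul_apply, Fin.sum_univ_three] <;> grind

/-- The permutation matrix of a 3-cycle. -/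
def shiftGL (F : Type*) [Field F] : GL (Fin 3) F where
  val := !![0, 0, 1; 1, 0, 0; 0, 1, 0]
  inv := !![0, 1, 0; 0, 0, 1; 1, 0, 0]
  val_inv := by
    ext i j
    fin_cases i <;> fin_cases j <;> simp [Matrix.mul_apply, Fin.sum_univ_three]
  inv_val := by
    ext i j
    fin_cases i <;> fin_cases j <;> simp [Matrix.mul_apply, Fin.sum_univ_three]

/-- The Fourier matrix `(w ^ (i * j))`, which has order four in characteristic two. -/
def fourierGL (w : F) (hw : w ^ 2 + w + 1 = 0) (h2 : (2 : F) = 0) : GL (Fin 3) F where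
  val := !![1, 1, 1; 1, w, w ^ 2; 1, w ^ 2, w]
  inv := !![1, 1, 1; 1, w ^ 2, w; 1, w, w ^ 2]
  val_inv := by
    ext i j
    fin_cases i <;> fin_cases j <;> simp [Matrix.mul_apply, Fin.sum_univ_three] <;> grind
  inv_val := by
    ext i j
    fin_cases i <;> fin_cases j <;> simp [Matrix.mul_apply, Fin.sum_univ_three] <;> grind

/-- The conjugate of the Fourier matrix by the diagonal matrix with entries `1, w, w`. -/
def twistedFourierGL (w : F) (hw : w ^ 2 + w + 1 = 0) (h2 : (2 : F) = 0) : GL (Fin 3) F where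
  val := !![1, w ^ 2, w ^ 2; w, w, w ^ 2; w, w ^ 2, w]
  inv := !![1, w ^ 2, w ^ 2; w, w ^ 2, w; w, w, w ^ 2]
  val_inv := by
    ext i j
    fin_cases i <;> fin_cases j <;> simp [Matrix.mul_apply, Fin.sum_univ_three] <;> grind
  inv_val := by
    ext i j
    fin_cases i <;> fin_cases j <;> simp [Matrix.mul_apply, Fin.sum_univ_three] <;> grind

theorem scalarGL_pow_three (w : F) (hw : w ^ 2 + w + 1 = 0) :
    (scalarGL w hw) ^ 3 = 1 := by
  ext i j
  fin_cases i <;> fin_cases j <;>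
    simp [scalarGL, pow_succ, Matrix.mul_apply, Fin.sum_univ_three] <;>
    grind

theorem clockGL_pow_three (w : F) (hw : w ^ 2 + w + 1 = 0) :
    (clockGL w hw) ^ 3 = 1 := by
  ext i j
  fin_cases i <;> fin_cases j <;>
    simp [clockGL, pow_succ, Matrix.mul_apply, Fin.sum_univ_three] <;>
    grind

theorem shiftGL_pow_three (F : Type*) [Field F] :
    (shiftGL F) ^ 3 = 1 := by
  ext i j
  fin_cases i <;> fin_cases j <;>
    simp [shiftGL, pow_succ, Matrix.mul_apply, Fin.sum_univ_three]

theorem fourierGL_pow_four (w : F) (hw : w ^ 2 + w + 1 = 0) (h2 : (2 : F) = 0) :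
    (fourierGL w hw h2) ^ 4 = 1 := by
  ext i j
  fin_cases i <;> fin_cases j <;>
    simp [fourierGL, pow_succ, Matrix.mul_apply, Fin.sum_univ_three] <;>
    grind

theorem twistedFourierGL_sq (w : F) (hw : w ^ 2 + w + 1 = 0) (h2 : (2 : F) = 0) :
    (twistedFourierGL w hw h2) ^ 2 = (fourierGL w hw h2) ^ 2 := by
  ext i j
  fin_cases i <;> fin_cases j <;>
    simp [fourierGL, twistedFourierGL, pow_succ, Matrix.mul_apply, Fin.sum_univ_three] <;>
    grind

theorem clockGL_mul_scalarGL (w : F) (hw : w ^ 2 + w + 1 = 0) :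
    clockGL w hw * scalarGL w hw = scalarGL w hw * clockGL w hw := by
  ext i j
  fin_cases i <;> fin_cases j <;>
    simp [scalarGL, clockGL, pow_succ, Matrix.mul_apply, Fin.sum_univ_three]
  grind

theorem shiftGL_mul_scalarGL (w : F) (hw : w ^ 2 + w + 1 = 0) :
    shiftGL F * scalarGL w hw = scalarGL w hw * shiftGL F := by
  ext i j
  fin_cases i <;> fin_cases j <;>
    simp [scalarGL, shiftGL, pow_succ, Matrix.mul_apply, Fin.sum_univ_three]

theorem fourierGL_mul_scalarGL (w : F) (hw : w ^ 2 + w + 1 = 0) (h2 : (2 : F) = 0) :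
    fourierGL w hw h2 * scalarGL w hw = scalarGL w hw * fourierGL w hw h2 := by
  ext i j
  fin_cases i <;> fin_cases j <;>
    simp [scalarGL, fourierGL, pow_succ, Matrix.mul_apply, Fin.sum_univ_three] <;>
    grind

theorem twistedFourierGL_mul_scalarGL (w : F) (hw : w ^ 2 + w + 1 = 0) (h2 : (2 : F) = 0) :
    twistedFourierGL w hw h2 * scalarGL w hw = scalarGL w hw * twistedFourierGL w hw h2 := by
  ext i j
  fin_cases i <;> fin_cases j <;>
    simp [scalarGL, twistedFourierGL, pow_succ, Matrix.mul_apply, Fin.sum_univ_three] <;>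
    grind

theorem shiftGL_mul_clockGL (w : F) (hw : w ^ 2 + w + 1 = 0) :
    shiftGL F * clockGL w hw = (scalarGL w hw) ^ 2 * clockGL w hw * shiftGL F := by
  ext i j
  fin_cases i <;> fin_cases j <;>
    simp [scalarGL, clockGL, shiftGL, pow_succ, Matrix.mul_apply, Fin.sum_univ_three] <;>
    grind

theorem fourierGL_mul_clockGL (w : F) (hw : w ^ 2 + w + 1 = 0) (h2 : (2 : F) = 0) :
    fourierGL w hw h2 * clockGL w hw = (shiftGL F) ^ 2 * fourierGL w hw h2 := by
  ext i j
  fin_cases i <;> fin_cases j <;>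
    simp [clockGL, shiftGL, fourierGL, pow_succ, Matrix.mul_apply, Fin.sum_univ_three] <;>
    grind

theorem fourierGL_mul_shiftGL (w : F) (hw : w ^ 2 + w + 1 = 0) (h2 : (2 : F) = 0) :
    fourierGL w hw h2 * shiftGL F = clockGL w hw * fourierGL w hw h2 := by
  ext i j
  fin_cases i <;> fin_cases j <;>
    simp [clockGL, shiftGL, fourierGL, pow_succ, Matrix.mul_apply, Fin.sum_univ_three] <;>
    grind

theorem twistedFourierGL_mul_clockGL (w : F) (hw : w ^ 2 + w + 1 = 0) (h2 : (2 : F) = 0) :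
    twistedFourierGL w hw h2 * clockGL w hw =
      scalarGL w hw * (shiftGL F) ^ 2 * clockGL w hw * twistedFourierGL w hw h2 := by
  ext i j
  fin_cases i <;> fin_cases j <;>
    simp [scalarGL, clockGL, shiftGL, twistedFourierGL, pow_succ, Matrix.mul_apply, Fin.sum_univ_three] <;>
    grind

theorem twistedFourierGL_mul_shiftGL (w : F) (hw : w ^ 2 + w + 1 = 0) (h2 : (2 : F) = 0) :
    twistedFourierGL w hw h2 * shiftGL F =
      (scalarGL w hw) ^ 2 * (shiftGL F) ^ 2 * (clockGL w hw) ^ 2 * twistedFourierGL w hw h2 := by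
  ext i j
  fin_cases i <;> fin_cases j <;>
    simp [scalarGL, clockGL, shiftGL, twistedFourierGL, pow_succ, Matrix.mul_apply, Fin.sum_univ_three] <;>
    grind

theorem twistedFourierGL_mul_fourierGL (w : F) (hw : w ^ 2 + w + 1 = 0) (h2 : (2 : F) = 0) :
    twistedFourierGL w hw h2 * fourierGL w hw h2 = (fourierGL w hw h2) ^ 3 * twistedFourierGL w hw h2 := by
  ext i j
  fin_cases i <;> fin_cases j <;>
    simp [fourierGL, twistedFourierGL, pow_succ, Matrix.mul_apply, Fin.sum_univ_three] <;>
    grind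

theorem fourierGL_sq_ne_one (w : F) (hw : w ^ 2 + w + 1 = 0) (h2 : (2 : F) = 0) :
    (fourierGL w hw h2) ^ 2 ≠ 1 := by
  intro h
  have h11 := Matrix.ext_iff.2 (Units.ext_iff.1 h) 1 1
  simp [fourierGL, pow_succ, Matrix.mul_apply, Fin.sum_univ_three] at h11
  grind

theorem extraspecialQuaternion_GL (w : F) (hw : w ^ 2 + w + 1 = 0) (h2 : (2 : F) = 0) :
    ExtraspecialQuaternion (scalarGL w hw) (clockGL w hw) (shiftGL F) (fourierGL w hw h2)
      (twistedFourierGL w hw h2) where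
  s_pow := scalarGL_pow_three w hw
  z_pow := clockGL_pow_three w hw
  x_pow := shiftGL_pow_three F
  a_pow := fourierGL_pow_four w hw h2
  b_sq := twistedFourierGL_sq w hw h2
  z_s := clockGL_mul_scalarGL w hw
  x_s := shiftGL_mul_scalarGL w hw
  a_s := fourierGL_mul_scalarGL w hw h2
  b_s := twistedFourierGL_mul_scalarGL w hw h2
  x_z := shiftGL_mul_clockGL w hw
  a_z := fourierGL_mul_clockGL w hw h2
  a_x := fourierGL_mul_shiftGL w hw h2
  b_z := twistedFourierGL_mul_clockGL w hw h2
  b_x := twistedFourierGL_mul_shiftGL w hw h2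
  b_a := twistedFourierGL_mul_fourierGL w hw h2
  a_sq_ne := fourierGL_sq_ne_one w hw h2

/-- A subspace of `F³` stable under the clock and shift matrices is trivial. -/
theorem eq_bot_or_eq_top_of_clockGL_shiftGL (w : F) (hw : w ^ 2 + w + 1 = 0) (h2 : (2 : F) = 0)
    (W : Submodule F (Fin 3 → F))
    (hz : ∀ v ∈ W, (clockGL w hw : Matrix (Fin 3) (Fin 3) F).mulVec v ∈ W)
    (hx : ∀ v ∈ W, (shiftGL F : Matrix (Fin 3) (Fin 3) F).mulVec v ∈ W) : W = ⊥ ∨ W = ⊤ := by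
  have hz' : ∀ p q r : F, ![p, q, r] ∈ W → ![p, w * q, w ^ 2 * r] ∈ W := fun p q r h => by
    convert hz _ h using 1
    ext i
    fin_cases i <;> simp [clockGL, Matrix.mulVec, dotProduct, Fin.sum_univ_three]
  have hx' : ∀ p q r : F, ![p, q, r] ∈ W → ![r, p, q] ∈ W := fun p q r h => by
    convert hx _ h using 1
    ext i
    fin_cases i <;> simp [shiftGL, Matrix.mulVec, dotProduct, Fin.sum_univ_three]
  have hproj : ∀ p q r : F, ![p, q, r] ∈ W → ![p, 0, 0] ∈ W := fun p q r h => by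
    have h1 := hz' _ _ _ h
    have hsum := W.add_mem (W.add_mem h h1) (hz' _ _ _ h1)
    convert hsum using 1
    ext i
    fin_cases i <;> simp <;> grind
  by_cases htop : ∃ p : F, p ≠ 0 ∧ ![p, 0, 0] ∈ W
  · right
    obtain ⟨p, hp, hpW⟩ := htop
    have hline : ∀ t : F, ![t, 0, 0] ∈ W := fun t => by
      simpa [hp] using W.smul_mem (t / p) hpW
    refine Submodule.eq_top_iff'.2 fun v => ?_
    have hmem := W.add_mem (W.add_mem (hline (v 0)) (hx' _ _ _ (hline (v 1))))
      (hx' _ _ _ (hx' _ _ _ (hline (v 2))))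
    convert hmem using 1
    ext i
    fin_cases i <;> simp
  · left
    push Not at htop
    have hzero : ∀ p q r : F, ![p, q, r] ∈ W → p = 0 := fun p q r h =>
      by_contra fun hp => htop p hp (hproj p q r h)
    refine (Submodule.eq_bot_iff W).2 fun v hv => ?_
    have hv' : ![v 0, v 1, v 2] ∈ W := by
      convert hv using 1
      ext i
      fin_cases i <;> rfl
    ext i
    fin_cases i
    · exact hzero _ _ _ hv'
    · exact hzero _ _ _ (hx' _ _ _ (hx' _ _ _ hv'))
    · exact hzero _ _ _ (hx' _ _ _ hv')

theorem exists_isIrredSolvable_three (w : F) (hw : w ^ 2 + w + 1 = 0) (h2 : (2 : F) = 0) :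
    ∃ G : Subgroup ((Fin 3 → F) ≃ₗ[F] (Fin 3 → F)), IsIrredSolvable G 3 := by
  let φ : GL (Fin 3) F ≃* ((Fin 3 → F) ≃ₗ[F] (Fin 3 → F)) :=
    Matrix.GeneralLinearGroup.toLin.trans (LinearMap.GeneralLinearGroup.generalLinearEquiv F _)
  obtain ⟨hsol, hcard, hfac⟩ := (extraspecialQuaternion_GL w hw h2).isSolvable_factorization_card
  set N := extraspecialQuaternionSubgroup (scalarGL w hw) (clockGL w hw) (shiftGL F)
    (fourierGL w hw h2) (twistedFourierGL w hw h2) with hN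
  have hle : extraspecialSubgroup (scalarGL w hw) (clockGL w hw) (shiftGL F) ≤ N :=
    le_sup_left.trans (le_sup_left.trans le_sup_left)
  have : Finite N := Nat.finite_of_card_ne_zero hcard
  let e : N ≃* N.map φ.toMonoidHom := N.equivMapOfInjective _ φ.injective
  refine ⟨N.map φ.toMonoidHom, Finite.of_equiv _ e.toEquiv,
    Group.isSolvable_of_surjective (f := e.toMonoidHom) e.surjective,
    by rw [← Nat.card_congr e.toEquiv, hfac], fun W hW => ?_, fun v hv => ?_⟩
  · exact eq_bot_or_eq_top_of_clockGL_shiftGL w hw h2 W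
      (fun v hv => hW _ ⟨_, hle (z_mem_extraspecialSubgroup _ _ _), rfl⟩ v hv)
      (fun v hv => hW _ ⟨_, hle (x_mem_extraspecialSubgroup _ _ _), rfl⟩ v hv)
  · have h := hv _ ⟨_, hle (s_mem_extraspecialSubgroup _ _ _), rfl⟩
    have h' : (scalarGL w hw : Matrix (Fin 3) (Fin 3) F).mulVec v = v := h
    have hs : (scalarGL w hw : Matrix (Fin 3) (Fin 3) F).mulVec v = w • v := by
      ext i
      fin_cases i <;> simp [scalarGL, Matrix.mulVec, dotProduct, Fin.sum_univ_three]
    rw [hs] at h'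
    have hw1 : w - 1 ≠ 0 := fun h1 => by
      have : w = 1 := sub_eq_zero.1 h1
      grind
    refine (smul_eq_zero.1 (?_ : (w - 1) • v = 0)).resolve_left hw1
    rw [sub_smul, h', one_smul, sub_self]

end BaseGroup

/-- Iterated wreath products with the group of order two of a linear group in dimension three. -/
theorem exists_isIrredSolvable {F : Type} [Field F] {w : F} (hw : w ^ 2 + w + 1 = 0)
    (h2 : (2 : F) = 0) (n : ℕ) :
    ∃ (V : Type) (_ : AddCommGroup V) (_ : Module F V) (G : Subgroup (V ≃ₗ[F] V)),
      Module.finrank F V = 3 * 2 ^ n ∧ IsIrredSolvable G (4 * 2 ^ n - 1) := by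
  induction n with
  | zero =>
    obtain ⟨G, hG⟩ := exists_isIrredSolvable_three w hw h2
    exact ⟨Fin 3 → F, inferInstance, inferInstance, G, by simp, hG⟩
  | succ n ih =>
    obtain ⟨V, _, _, G, hV, hG⟩ := ih
    have hpos : 0 < Module.finrank F V := by rw [hV]; positivity
    have : FiniteDimensional F V := Module.finite_of_finrank_pos hpos
    have : Nontrivial V := Module.nontrivial_of_finrank_pos hpos
    refine ⟨V × V, inferInstance, inferInstance, wreathTwo G, ?_, ?_⟩
    · rw [Module.finrank_prod, hV]
      ring
    · have hk : 4 * 2 ^ (n + 1) - 1 = 2 * (4 * 2 ^ n - 1) + 1 := by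
        have : 0 < 2 ^ n := by positivity
        rw [pow_succ]
        omega
      rw [hk]
      exact hG.wreathTwo

/-- **Example (Ex6).**  For `q = 2 ^ f` with `f` even and every `n ≥ 1` there is an
irreducible subgroup `G` of `GL(d, q)`, `d = 3·2^{n-1}`, with `c_2(G) = (4/3)·d − 1`,
i.e. `3·c_2(G) = 4·d − 3`. -/
theorem exists_irreducible_subgroup_c2_eq (f n d : ℕ) (hf : 0 < f) (hfe : Even f)
    (hn : 1 ≤ n) (hd : d = 3 * 2 ^ (n - 1))
    (F : Type) [Field F] [Fintype F] (hF : Fintype.card F = 2 ^ f) :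
    ∃ G : Subgroup (Matrix.GeneralLinearGroup (Fin d) F),
      natIrreducible G ∧ 3 * cp 2 ↥G = 4 * d - 3 := by
  obtain ⟨h2, w, hw⟩ := exists_primitive_cube_root hf hfe hF
  obtain ⟨V, _, _, G, hV, hG⟩ := exists_isIrredSolvable hw h2 (n - 1)
  have hpos : 0 < Module.finrank F V := by rw [hV]; positivity
  have : FiniteDimensional F V := Module.finite_of_finrank_pos hpos
  have : Nontrivial V := Module.nontrivial_of_finrank_pos hpos
  obtain ⟨H, hH, hcp⟩ := hG.exists_natIrreducible (hV.trans hd.symm)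
  refine ⟨H, hH, ?_⟩
  have : 0 < 2 ^ (n - 1) := by positivity
  rw [hcp]
  omega
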